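/- Let B : Matrix (Fin m) (Fin n) ℝ and suppose M = Bᵀ * B is invertible. Let p̂, q : Fin m → ℝ and set z = M⁻¹.mulVec (Bᵀ.mulVec p̂). Let C be the operator norm of the linear map from EuclideanSpace ℝ (Fin m) to EuclideanSpace ℝ (Fin n) given by x ↦ M⁻¹.mulVec (Bᵀ.mulVec x). Then for every Π : Fin n → ℝ, ∑_{i : Fin n} (Π i − z i)² ≤ 3 * C² * ( ‖B.mulVec Π − q‖₂² + ‖q − p̂‖₂² + ‖B.mulVec z − p̂‖₂² ), where ‖·‖₂ denotes the Euclidean norm on ℝ^m. -/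

import Mathlib

open Matrix

/-- Euclidean norm on `Fin m → ℝ`. -/
noncomputable def euNorm {m : ℕ} (v : Fin m → ℝ) : ℝ := Real.sqrt (∑ k, (v k) ^ 2)

lemma euNorm_sq {m : ℕ} (v : Fin m → ℝ) : euNorm v ^ 2 = ∑ k, v k ^ 2 :=
  Real.sq_sqrt (Finset.sum_nonneg fun _ _ => sq_nonneg _)

/-- Squared triangle inequality through an intermediate point, up to a factor `2`. -/
lemma euNorm_sub_sq_le {m : ℕ} (a b c : Fin m → ℝ) :
    euNorm (a - c) ^ 2 ≤ 2 * (euNorm (a - b) ^ 2 + euNorm (b - c) ^ 2) := by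
  simp only [euNorm_sq, ← Finset.sum_add_distrib, Finset.mul_sum, Pi.sub_apply]
  refine Finset.sum_le_sum fun k _ => ?_
  nlinarith [sq_nonneg ((a k - b k) - (b k - c k))]

/-- Inequalities (ineq4)–(ineq7) in the proof of Proposition 1: the squared coefficient error of
the Gappy-POD coefficients `z = M⁻¹ Bᵀ phat` is bounded by `3 C²` times the sum of three squared
residuals, where `C` is the operator norm of `x ↦ M⁻¹ Bᵀ x` between Euclidean spaces. -/
theorem stmt5 {m n : ℕ}
    (B : Matrix (Fin m) (Fin n) ℝ)
    (M : Matrix (Fin n) (Fin n) ℝ) (hM : M = Bᵀ * B) (hMinv : IsUnit M.det)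
    (phat q : Fin m → ℝ)
    (T : EuclideanSpace ℝ (Fin m) →L[ℝ] EuclideanSpace ℝ (Fin n))
    (hT : ∀ x : EuclideanSpace ℝ (Fin m), T x = M⁻¹.mulVec (Bᵀ.mulVec x))
    (C : ℝ) (hC : C = ‖T‖) :
    ∀ Pvec : Fin n → ℝ,
      ∑ i, (Pvec i - (M⁻¹.mulVec (Bᵀ.mulVec phat)) i) ^ 2 ≤
        3 * C ^ 2 *
          ((euNorm (B.mulVec Pvec - q)) ^ 2 + (euNorm (q - phat)) ^ 2
            + (euNorm (B.mulVec (M⁻¹.mulVec (Bᵀ.mulVec phat)) - phat)) ^ 2) := by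
  intro Pvec
  subst hC
  have hTy : ∀ i, T (WithLp.toLp 2 (B.mulVec Pvec - phat)) i =
      Pvec i - (M⁻¹.mulVec (Bᵀ.mulVec phat)) i := by
    intro i
    have hsplit : M⁻¹.mulVec (Bᵀ.mulVec (B.mulVec Pvec - phat)) =
        Pvec - M⁻¹.mulVec (Bᵀ.mulVec phat) := by
      rw [Matrix.mulVec_sub, Matrix.mulVec_sub, Matrix.mulVec_mulVec Pvec Bᵀ B, ← hM,
        Matrix.mulVec_mulVec, Matrix.nonsing_inv_mul M hMinv, Matrix.one_mulVec]
    simpa using congrFun ((hT _).trans hsplit) i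
  have hop : ∑ i, (Pvec i - (M⁻¹.mulVec (Bᵀ.mulVec phat)) i) ^ 2 ≤
      ‖T‖ ^ 2 * euNorm (B.mulVec Pvec - phat) ^ 2 := by
    have h := pow_le_pow_left₀ (norm_nonneg _)
      (T.le_opNorm (WithLp.toLp 2 (B.mulVec Pvec - phat))) 2
    rw [mul_pow, EuclideanSpace.real_norm_sq_eq, EuclideanSpace.real_norm_sq_eq] at h
    simpa only [hTy, euNorm_sq] using h
  have hres : euNorm (B.mulVec Pvec - phat) ^ 2 ≤
      3 * (euNorm (B.mulVec Pvec - q) ^ 2 + euNorm (q - phat) ^ 2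
        + euNorm (B.mulVec (M⁻¹.mulVec (Bᵀ.mulVec phat)) - phat) ^ 2) := by
    linarith [euNorm_sub_sq_le (B.mulVec Pvec) q phat, sq_nonneg (euNorm (B.mulVec Pvec - q)),
      sq_nonneg (euNorm (q - phat)),
      sq_nonneg (euNorm (B.mulVec (M⁻¹.mulVec (Bᵀ.mulVec phat)) - phat))]
  calc _ ≤ _ := hop
    _ ≤ _ := mul_le_mul_of_nonneg_left hres (sq_nonneg _)
    _ = _ := by ring
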